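/- arXiv:2003.08347 — 2 statements merged into one kernel-verified Lean document; each statement's English description precedes it below -/
import Mathlib

section
/- Let (π, H) be a square-integrable σ-representation of a countable discrete group Γ on a separable complex Hilbert space H. Then for every h ∈ H there exists g ∈ H such that π(Γ)g is a Parseval frame for the closed linear span [π(Γ)h] of {π(γ)h : γ ∈ Γ}; that is, π(γ)g ∈ [π(Γ)h] for all γ ∈ Γ and Σ_{γ∈Γ} |⟨f, π(γ)g⟩|² = ‖f‖² for all f ∈ [π(Γ)h]. In particular, if π admits a cyclic vector, then there exists g ∈ H such that π(Γ)g is a Parseval frame for H. -/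
open MeasureTheory
open scoped ENNReal ComplexInnerProductSpace

noncomputable section

section Defs

variable {Γ : Type*} [Group Γ] {H : Type*} [NormedAddCommGroup H] [InnerProductSpace ℂ H]

/-- A projective unitary `σ`-representation: `|σ| = 1`, cocycle identity, normalization,
`π 1 = I`, and `π x π y = σ(x,y) π(xy)`. -/
def IsProjectiveRep (σ : Γ → Γ → ℂ) (π : Γ → H ≃ₗᵢ[ℂ] H) : Prop :=
  (∀ x y : Γ, ‖σ x y‖ = 1) ∧
  (∀ x y z : Γ, σ x (y * z) * σ y z = σ (x * y) z * σ x y) ∧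
  (∀ x : Γ, σ x 1 = 1 ∧ σ 1 x = 1) ∧
  π 1 = LinearIsometryEquiv.refl ℂ H ∧
  ∀ x y : Γ, ∀ f : H, π x (π y f) = σ x y • π (x * y) f

/-- `g` is a Bessel vector for the family `(π γ g)_γ`. -/
def IsBesselVector (π : Γ → H ≃ₗᵢ[ℂ] H) (g : H) : Prop :=
  ∃ B : ℝ, 0 < B ∧ ∀ f : H,
    (Summable fun γ : Γ => ‖⟪f, π γ g⟫‖ ^ 2) ∧
      (∑' γ : Γ, ‖⟪f, π γ g⟫‖ ^ 2) ≤ B * ‖f‖ ^ 2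

/-- Square-integrability: square-summable matrix coefficients on a dense subspace. -/
def IsSquareIntegrableRep (π : Γ → H ≃ₗᵢ[ℂ] H) : Prop :=
  ∃ D : Submodule ℂ H, Dense (D : Set H) ∧
    ∀ f : H, ∀ g ∈ D, Summable fun γ : Γ => ‖⟪f, π γ g⟫‖ ^ 2

/-- The commutant `π(Γ)'`. -/
def RepCommutant (π : Γ → H ≃ₗᵢ[ℂ] H) : Set (H →L[ℂ] H) :=
  {T | ∀ (γ : Γ) (f : H), T (π γ f) = π γ (T f)}

/-- The double commutant `π(Γ)''`. -/
def RepBicommutant (π : Γ → H ≃ₗᵢ[ℂ] H) : Set (H →L[ℂ] H) :=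
  {T | ∀ S ∈ RepCommutant π, ∀ f : H, T (S f) = S (T f)}

/-- `h` is separating for `π(Γ)''`. -/
def IsSeparatingVector (π : Γ → H ≃ₗᵢ[ℂ] H) (h : H) : Prop :=
  ∀ T ∈ RepBicommutant π, T h = 0 → T = 0

/-- `(π γ g)_γ` is a Parseval frame for `H`. -/
def IsParsevalFrame (π : Γ → H ≃ₗᵢ[ℂ] H) (g : H) : Prop :=
  ∀ f : H, HasSum (fun γ : Γ => ‖⟪f, π γ g⟫‖ ^ 2) (‖f‖ ^ 2)

/-- `(π γ g)_γ` is a frame for `H`. -/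
def IsFrame (π : Γ → H ≃ₗᵢ[ℂ] H) (g : H) : Prop :=
  ∃ A B : ℝ, 0 < A ∧ 0 < B ∧ ∀ f : H,
    (Summable fun γ : Γ => ‖⟪f, π γ g⟫‖ ^ 2) ∧
      A * ‖f‖ ^ 2 ≤ (∑' γ : Γ, ‖⟪f, π γ g⟫‖ ^ 2) ∧
      (∑' γ : Γ, ‖⟪f, π γ g⟫‖ ^ 2) ≤ B * ‖f‖ ^ 2

/-- `(π γ g)_γ` is a Riesz sequence. -/
def IsRieszSequence (π : Γ → H ≃ₗᵢ[ℂ] H) (g : H) : Prop :=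
  ∃ A B : ℝ, 0 < A ∧ 0 < B ∧ ∀ (s : Finset Γ) (c : Γ → ℂ),
    A * ∑ γ ∈ s, ‖c γ‖ ^ 2 ≤ ‖∑ γ ∈ s, c γ • π γ g‖ ^ 2 ∧
      ‖∑ γ ∈ s, c γ • π γ g‖ ^ 2 ≤ B * ∑ γ ∈ s, ‖c γ‖ ^ 2

/-- `g` is cyclic: the orbit `π(Γ)g` has dense linear span. -/
def IsCyclicVector (π : Γ → H ≃ₗᵢ[ℂ] H) (g : H) : Prop :=
  Dense ((Submodule.span ℂ (Set.range fun γ : Γ => π γ g) : Submodule ℂ H) : Set H)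

/-- `γ₀` is `σ`-regular. -/
def IsSigmaRegular (σ : Γ → Γ → ℂ) (γ₀ : Γ) : Prop :=
  ∀ γ : Γ, γ * γ₀ = γ₀ * γ → σ γ₀ γ = σ γ γ₀

/-- Kleppner's condition for `(Γ, σ)`. -/
def KleppnerCondition (σ : Γ → Γ → ℂ) : Prop :=
  ∀ γ₀ : Γ, γ₀ ≠ 1 → IsSigmaRegular σ γ₀ →
    {x : Γ | ∃ γ : Γ, γ * γ₀ * γ⁻¹ = x}.Infinite

end Defs


set_option linter.unusedSectionVars false

section Aux

variable {Γ : Type*} [Group Γ] {H : Type*} [NormedAddCommGroup H] [InnerProductSpace ℂ H]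

lemma aux_coef {σ : Γ → Γ → ℂ} {π : Γ → H ≃ₗᵢ[ℂ] H} (hrep : IsProjectiveRep σ π)
    (h v : H) (γ x : Γ) : ‖⟪π x h, π γ v⟫‖ = ‖⟪π (γ⁻¹ * x) h, v⟫‖ := by
  obtain ⟨h1, -, -, -, h5⟩ := hrep
  have e := h5 γ (γ⁻¹ * x) h
  rw [mul_inv_cancel_left] at e
  rw [← (π γ).inner_map_map (π (γ⁻¹ * x) h) v, e, inner_smul_left, norm_mul]
  simp [h1]

lemma aux_coef_symm {σ : Γ → Γ → ℂ} {π : Γ → H ≃ₗᵢ[ℂ] H} (hrep : IsProjectiveRep σ π)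
    (h v : H) (γ x : Γ) : ‖⟪π x h, (π γ).symm v⟫‖ = ‖⟪π (γ * x) h, v⟫‖ := by
  have := aux_coef hrep h ((π γ).symm v) γ (γ * x)
  simpa using this.symm

/-- norm squares in `ℓ²` -/
lemma aux_hasSum (c : lp (fun _ : Γ => ℂ) 2) : HasSum (fun x => ‖c x‖ ^ 2) (‖c‖ ^ 2) := by
  have := lp.hasSum_norm (p := 2) (by norm_num) c
  simpa using this

lemma aux_memlp {c : Γ → ℂ} (hc : Summable fun x => ‖c x‖ ^ 2) : Memℓp c 2 := by
  rw [memℓp_gen_iff (by norm_num)]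
  simpa using hc

lemma aux_norm_eq (c d : lp (fun _ : Γ => ℂ) 2) (e : Γ ≃ Γ) (hcd : ∀ x, ‖c x‖ = ‖d (e x)‖) :
    ‖c‖ = ‖d‖ := by
  have h1 := aux_hasSum c
  have h2 := (e.hasSum_iff).2 (aux_hasSum d)
  have h3 : (fun x => ‖c x‖ ^ 2) = (fun x => ‖d x‖ ^ 2) ∘ e := by
    funext x; simp [hcd]
  rw [h3] at h1
  have := h1.unique h2
  exact (sq_eq_sq₀ (norm_nonneg _) (norm_nonneg _)).1 this

variable [CompleteSpace H]

lemma aux_comm {F : Type*} [NormedAddCommGroup F] [InnerProductSpace ℂ F] [CompleteSpace F]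
    (B : H →L[ℂ] F) (U : H ≃ₗᵢ[ℂ] H) (hB : ∀ f, ‖B (U f)‖ = ‖B f‖) (f : H) :
    (B.adjoint ∘L B) (U f) = U ((B.adjoint ∘L B) f) := by
  set S := B.adjoint ∘L B with hS
  have key : (U.symm.toLinearEquiv.toLinearMap ∘ₗ S.toLinearMap ∘ₗ U.toLinearEquiv.toLinearMap)
      = S.toLinearMap := by
    rw [← ext_inner_map]
    intro x
    have e1 : ⟪S x, x⟫ = ((‖B x‖ ^ 2 : ℝ) : ℂ) := by
      simp [hS, ContinuousLinearMap.adjoint_inner_left, inner_self_eq_norm_sq_to_K]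
    have e2 : ⟪S (U x), U x⟫ = ((‖B (U x)‖ ^ 2 : ℝ) : ℂ) := by
      simp [hS, ContinuousLinearMap.adjoint_inner_left, inner_self_eq_norm_sq_to_K]
    have e3 : ⟪U.symm (S (U x)), x⟫ = ⟪S (U x), U x⟫ := by
      rw [← U.inner_map_map, U.apply_symm_apply]
    change ⟪U.symm (S (U x)), x⟫ = ⟪S x, x⟫
    rw [e3, e2, e1, hB]
  have := congrArg (fun L => L f) key
  change U.symm (S (U f)) = S f at this
  rw [← this, U.apply_symm_apply]

lemma aux_polar {F : Type*} [NormedAddCommGroup F] [InnerProductSpace ℂ F] [CompleteSpace F]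
    (A : H →L[ℂ] F) : ∃ P : H →L[ℂ] H, IsSelfAdjoint P ∧ (∀ f, ‖P f‖ = ‖A f‖) ∧
      ∀ U : H ≃ₗᵢ[ℂ] H, (∀ f, ‖A (U f)‖ = ‖A f‖) → ∀ f, P (U f) = U (P f) := by
  set S := A.adjoint ∘L A with hS
  have hS0 : 0 ≤ S := (ContinuousLinearMap.nonneg_iff_isPositive _).2
    (ContinuousLinearMap.isPositive_adjoint_comp_self A)
  have hsa : IsSelfAdjoint (CFC.sqrt S) := IsSelfAdjoint.of_nonneg (CFC.sqrt_nonneg S)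
  refine ⟨CFC.sqrt S, hsa, ?_, ?_⟩
  · intro f
    have hm : CFC.sqrt S (CFC.sqrt S f) = S f :=
      congrArg (fun L : H →L[ℂ] H => L f) (CFC.sqrt_mul_sqrt_self S hS0)
    have e1 : ⟪CFC.sqrt S f, CFC.sqrt S f⟫ = ⟪A f, A f⟫ := by
      rw [← ContinuousLinearMap.adjoint_inner_left,
        ContinuousLinearMap.isSelfAdjoint_iff'.1 hsa, hm]
      simp [hS, ContinuousLinearMap.adjoint_inner_left]
    rw [inner_self_eq_norm_sq_to_K, inner_self_eq_norm_sq_to_K] at e1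
    have e2 : ‖CFC.sqrt S f‖ ^ 2 = ‖A f‖ ^ 2 := by exact_mod_cast e1
    exact (sq_eq_sq₀ (norm_nonneg _) (norm_nonneg _)).1 e2
  · intro U hU f
    have hc : Commute S (U.toContinuousLinearEquiv : H →L[ℂ] H) := by
      ext f
      exact aux_comm A U hU f
    have hc2 : Commute (CFC.sqrt S) (U.toContinuousLinearEquiv : H →L[ℂ] H) :=
      hc.cfcₙ_nnreal _
    exact congrArg (fun L : H →L[ℂ] H => L f) hc2.eq

/-- The graph of the analysis operator. -/
def auxG (π : Γ → H ≃ₗᵢ[ℂ] H) (h : H) :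
    Submodule ℂ (WithLp 2 (H × lp (fun _ : Γ => ℂ) 2)) where
  carrier := {w | ∀ x, w.snd x = ⟪π x h, w.fst⟫}
  add_mem' := by
    intro a b ha hb x
    simp only [Set.mem_ofPred_eq] at ha hb
    simp [ha x, hb x]
  zero_mem' := by intro x; simp
  smul_mem' := by
    intro c a ha x
    simp only [Set.mem_ofPred_eq] at ha
    simp [ha x]

lemma auxG_closed (π : Γ → H ≃ₗᵢ[ℂ] H) (h : H) : IsClosed (auxG π h : Set (WithLp 2 (H × lp (fun _ : Γ => ℂ) 2))) := by
  have : (auxG π h : Set (WithLp 2 (H × lp (fun _ : Γ => ℂ) 2)))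
      = ⋂ x, {w | w.snd x = ⟪π x h, w.fst⟫} := by
    ext w; rw [Set.mem_iInter]; rfl
  rw [this]
  refine isClosed_iInter fun x => isClosed_eq ?_ ?_
  · have h1 : Continuous fun c : lp (fun _ : Γ => ℂ) 2 => c x :=
      (lp.evalCLM ℂ (fun _ : Γ => ℂ) 2 x).continuous
    exact h1.comp (WithLp.sndL 2 ℂ H (lp (fun _ : Γ => ℂ) 2)).continuous
  · have h1 : Continuous fun c : H => ⟪π x h, c⟫ := by fun_prop
    exact h1.comp (WithLp.fstL 2 ℂ H (lp (fun _ : Γ => ℂ) 2)).continuous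

lemma aux_op_abs {σ : Γ → Γ → ℂ} {π : Γ → H ≃ₗᵢ[ℂ] H} (hrep : IsProjectiveRep σ π)
    (hsq : IsSquareIntegrableRep π) (h : H)
    {G : Type*} [NormedAddCommGroup G] [InnerProductSpace ℂ G] [CompleteSpace G]
    (p1 : G →L[ℂ] H) (p2 : G →L[ℂ] lp (fun _ : Γ => ℂ) 2)
    (hG : ∀ (w : G) x, p2 w x = ⟪π x h, p1 w⟫)
    (hinner : ∀ w w' : G, ⟪w, w'⟫ = ⟪p1 w, p1 w'⟫ + ⟪p2 w, p2 w'⟫)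
    (hnorm : ∀ w : G, ‖w‖ ^ 2 = ‖p1 w‖ ^ 2 + ‖p2 w‖ ^ 2)
    (hmk : ∀ (v : H) (d : lp (fun _ : Γ => ℂ) 2), (∀ x, d x = ⟪π x h, v⟫) →
      ∃ w : G, p1 w = v ∧ p2 w = d) :
    ∃ (T : H →L[ℂ] H) (A : H →L[ℂ] lp (fun _ : Γ => ℂ) 2),
      (∀ f x, A f x = ⟪π x h, T f⟫) ∧ (∀ γ f, T (π γ f) = π γ (T f)) ∧
      (∀ f, A f = 0 ↔ ∀ x, ⟪π x h, f⟫ = 0) := by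
  -- moving elements of the graph
  have hmove : ∀ (U : H ≃ₗᵢ[ℂ] H) (e : Γ ≃ Γ),
      (∀ x v, ‖⟪π x h, U v⟫‖ = ‖⟪π (e x) h, v⟫‖) →
      ∀ w : G, ∃ w' : G, p1 w' = U (p1 w) ∧ ‖w'‖ = ‖w‖ := by
    intro U e hU w
    have hs : Summable fun x => ‖⟪π x h, U (p1 w)⟫‖ ^ 2 := by
      have h2 := ((e.hasSum_iff).2 (aux_hasSum (p2 w))).summable
      refine h2.congr fun x => ?_
      simp [hU, hG]
    obtain ⟨w', h1, h2⟩ := hmk (U (p1 w)) ⟨_, aux_memlp hs⟩ (fun x => rfl)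
    refine ⟨w', h1, ?_⟩
    have h3 : ‖p2 w'‖ = ‖p2 w‖ := by
      apply aux_norm_eq _ _ e
      intro x
      rw [hG, hG, h1, hU]
    have h4 : ‖w'‖ ^ 2 = ‖w‖ ^ 2 := by
      rw [hnorm, hnorm, h1, h3, U.norm_map]
    exact (sq_eq_sq₀ (norm_nonneg _) (norm_nonneg _)).1 h4
  have hmove1 : ∀ γ, ∀ w : G, ∃ w' : G, p1 w' = π γ (p1 w) ∧ ‖w'‖ = ‖w‖ := fun γ =>
    hmove (π γ) (Equiv.mulLeft γ⁻¹) (fun x v => aux_coef hrep h v γ x)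
  have hmove2 : ∀ γ, ∀ w : G, ∃ w' : G, p1 w' = (π γ).symm (p1 w) ∧ ‖w'‖ = ‖w‖ := fun γ =>
    hmove (π γ).symm (Equiv.mulLeft γ) (fun x v => aux_coef_symm hrep h v γ x)
  -- norm invariance of the adjoint
  have hle : ∀ (U : H ≃ₗᵢ[ℂ] H), (∀ w : G, ∃ w' : G, p1 w' = U.symm (p1 w) ∧ ‖w'‖ = ‖w‖) →
      ∀ f, ‖p1.adjoint (U f)‖ ≤ ‖p1.adjoint f‖ := by
    intro U hU f
    set w := p1.adjoint (U f) with hw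
    obtain ⟨w', h1, h2⟩ := hU w
    have h3 : ⟪w, w⟫ = ⟪p1.adjoint f, w'⟫ := by
      have e1 : ⟪p1.adjoint f, w'⟫ = ⟪U f, p1 w⟫ := by
        rw [ContinuousLinearMap.adjoint_inner_left, h1, ← U.inner_map_map f, U.apply_symm_apply]
      rw [e1, hw, ContinuousLinearMap.adjoint_inner_left]
    have h4 : ‖w‖ * ‖w‖ ≤ ‖p1.adjoint f‖ * ‖w‖ := by
      have e2 : ‖⟪w, w⟫‖ = ‖w‖ * ‖w‖ := by
        rw [inner_self_eq_norm_sq_to_K (𝕜 := ℂ) w]; simp [sq]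
      rw [← e2, h3]
      exact (norm_inner_le_norm (𝕜 := ℂ) (p1.adjoint f) w').trans (by rw [h2])
    by_cases hw0 : ‖w‖ = 0
    · rw [hw0]; positivity
    · exact le_of_mul_le_mul_right h4 (lt_of_le_of_ne (norm_nonneg _) (Ne.symm hw0))
  have heq : ∀ γ f, ‖p1.adjoint (π γ f)‖ = ‖p1.adjoint f‖ := by
    intro γ f
    refine le_antisymm (hle (π γ) (hmove2 γ) f) ?_
    have := hle (π γ).symm (by simpa using hmove1 γ) (π γ f)
    simpa using this
  have hT : ∀ γ f, p1 (p1.adjoint (π γ f)) = π γ (p1 (p1.adjoint f)) := by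
    intro γ f
    have := aux_comm p1.adjoint (π γ) (heq γ) f
    simpa using this
  -- density of the domain
  have hdense : DenseRange p1 := by
    obtain ⟨D, hD, hDs⟩ := hsq
    refine hD.mono ?_
    intro f hf
    have hs : Summable fun x => ‖⟪π x h, f⟫‖ ^ 2 := by
      have h1 := ((Equiv.inv Γ).summable_iff).2 (hDs h f hf)
      refine h1.congr fun x => ?_
      have h2 := aux_coef hrep h f x⁻¹ 1
      rw [hrep.2.2.2.1] at h2
      simp at h2
      simp [h2]
    obtain ⟨w, h1, -⟩ := hmk f ⟨_, aux_memlp hs⟩ (fun x => rfl)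
    exact ⟨w, h1⟩
  refine ⟨p1 ∘L p1.adjoint, p2 ∘L p1.adjoint, fun f x => hG _ x, hT, ?_⟩
  intro f
  constructor
  · intro hf
    change p2 (p1.adjoint f) = 0 at hf
    have h1 : p1 (p1.adjoint f) = f := by
      refine hdense.eq_of_inner_left ℂ ?_
      intro w
      have h2 := hinner (p1.adjoint f) w
      rw [hf, inner_zero_left, add_zero, ContinuousLinearMap.adjoint_inner_left] at h2
      exact h2.symm
    intro x
    rw [← h1, ← hG, hf]
    rfl
  · intro hf
    obtain ⟨w, h1, h2⟩ := hmk f 0 (fun x => by simp [hf])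
    have h3 : p1.adjoint f = w := by
      refine ext_inner_right ℂ fun v => ?_
      rw [ContinuousLinearMap.adjoint_inner_left, hinner, h1, h2, inner_zero_left, add_zero]
    change p2 (p1.adjoint f) = 0
    rw [h3, h2]

lemma aux_op {σ : Γ → Γ → ℂ} {π : Γ → H ≃ₗᵢ[ℂ] H} (hrep : IsProjectiveRep σ π)
    (hsq : IsSquareIntegrableRep π) (h : H) :
    ∃ (T : H →L[ℂ] H) (A : H →L[ℂ] lp (fun _ : Γ => ℂ) 2),
      (∀ f x, A f x = ⟪π x h, T f⟫) ∧ (∀ γ f, T (π γ f) = π γ (T f)) ∧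
      (∀ f, A f = 0 ↔ ∀ x, ⟪π x h, f⟫ = 0) := by
  let G : Submodule ℂ (WithLp 2 (H × lp (fun _ : Γ => ℂ) 2)) := auxG π h
  have : CompleteSpace G := (auxG_closed π h).completeSpace_coe
  let p1 : G →L[ℂ] H := (WithLp.fstL 2 ℂ H (lp (fun _ : Γ => ℂ) 2)).comp G.subtypeL
  let p2 : G →L[ℂ] lp (fun _ : Γ => ℂ) 2 :=
    (WithLp.sndL 2 ℂ H (lp (fun _ : Γ => ℂ) 2)).comp G.subtypeL
  have hG : ∀ (w : G) x, p2 w x = ⟪π x h, p1 w⟫ := fun w x => w.2 x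
  have hinner : ∀ w w' : G, ⟪w, w'⟫ = ⟪p1 w, p1 w'⟫ + ⟪p2 w, p2 w'⟫ := by
    intro w w'
    exact WithLp.prod_inner_apply _ _
  have hnorm : ∀ w : G, ‖w‖ ^ 2 = ‖p1 w‖ ^ 2 + ‖p2 w‖ ^ 2 := by
    intro w
    exact WithLp.prod_norm_sq_eq_of_L2 (w : WithLp 2 (H × lp (fun _ : Γ => ℂ) 2))
  have hmk : ∀ (v : H) (d : lp (fun _ : Γ => ℂ) 2), (∀ x, d x = ⟪π x h, v⟫) →
      ∃ w : G, p1 w = v ∧ p2 w = d := by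
    intro v d hd
    exact ⟨⟨WithLp.toLp 2 (v, d), hd⟩, rfl, rfl⟩
  exact aux_op_abs hrep hsq h p1 p2 hG hinner hnorm hmk

lemma aux_main {σ : Γ → Γ → ℂ} {π : Γ → H ≃ₗᵢ[ℂ] H} (hrep : IsProjectiveRep σ π)
    (hsq : IsSquareIntegrableRep π) (h : H) : ∃ g : H,
      (∀ γ : Γ, π γ g ∈
        (Submodule.span ℂ (Set.range fun γ' : Γ => π γ' h)).topologicalClosure) ∧
      ∀ f ∈ (Submodule.span ℂ (Set.range fun γ' : Γ => π γ' h)).topologicalClosure,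
        HasSum (fun γ : Γ => ‖⟪f, π γ g⟫‖ ^ 2) (‖f‖ ^ 2) := by
  set K := (Submodule.span ℂ (Set.range fun γ' : Γ => π γ' h)).topologicalClosure with hK
  have hKc : IsClosed (K : Set H) := Submodule.isClosed_topologicalClosure _
  have : CompleteSpace K := hKc.completeSpace_coe
  have hperp : ∀ f, f ∈ Kᗮ ↔ ∀ x, ⟪π x h, f⟫ = 0 := by
    intro f
    rw [hK, Submodule.orthogonal_closure]
    constructor
    · intro hf x
      exact hf _ (Submodule.subset_span ⟨x, rfl⟩)
    · intro hf
      rw [Submodule.mem_orthogonal]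
      intro u hu
      induction hu using Submodule.span_induction with
      | mem u hu => obtain ⟨x, rfl⟩ := hu; exact hf x
      | zero => simp
      | add a b _ _ ha hb => rw [inner_add_left, ha, hb, add_zero]
      | smul c a _ ha => rw [inner_smul_left, ha, mul_zero]
  obtain ⟨T, A, hA, hT, hker⟩ := aux_op hrep hsq h
  obtain ⟨P, hPsa, hPn, hPc⟩ := aux_polar A
  have hAπ : ∀ γ f, ‖A (π γ f)‖ = ‖A f‖ := by
    intro γ f
    apply aux_norm_eq _ _ (Equiv.mulLeft γ⁻¹)
    intro x
    rw [hA, hA, hT, aux_coef hrep]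
    rfl
  have hPπ : ∀ γ f, P (π γ f) = π γ (P f) := fun γ => hPc (π γ) (hAπ γ)
  have hPker : P.ker = Kᗮ := by
    ext f
    rw [hperp, ← hker, LinearMap.mem_ker, ← norm_eq_zero (a := A f), ← hPn, norm_eq_zero]
    rfl
  have hcl : P.range.topologicalClosure = K := by
    rw [← Submodule.orthogonal_orthogonal_eq_closure, ContinuousLinearMap.orthogonal_range,
      ContinuousLinearMap.isSelfAdjoint_iff'.1 hPsa, hPker, Submodule.orthogonal_orthogonal]
  have hPK : ∀ f, P f ∈ K := by
    intro f
    rw [← hcl]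
    exact Submodule.le_topologicalClosure _ ⟨f, rfl⟩
  let P' : H →ₗ[ℂ] K := P.toLinearMap.codRestrict K hPK
  have hP'd : DenseRange P' := by
    intro u
    rw [closure_subtype]
    have h1 : (u : H) ∈ P.range.topologicalClosure := by rw [hcl]; exact u.2
    have h2 : Set.image (Subtype.val : K → H) (Set.range P') = (P.range : Set H) := by
      ext y
      constructor
      · rintro ⟨_, ⟨f, rfl⟩, rfl⟩
        exact ⟨f, rfl⟩
      · rintro ⟨f, rfl⟩
        exact ⟨_, ⟨f, rfl⟩, rfl⟩
    rw [h2]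
    exact h1
  have hbd : ∀ f, ‖A.toLinearMap f‖ = ‖P' f‖ := fun f => (hPn f).symm
  let V : K →L[ℂ] lp (fun _ : Γ => ℂ) 2 := A.toLinearMap.extendOfNorm P'
  have hV : ∀ f, V (P' f) = A f :=
    fun f => LinearMap.extendOfNorm_eq hP'd ⟨1, fun x => by rw [hbd, one_mul]⟩ f
  have hVn : ∀ u, ‖V u‖ = ‖u‖ := by
    intro u
    refine hP'd.induction_on (p := fun u => ‖V u‖ = ‖u‖) u
      (isClosed_eq (by fun_prop) (by fun_prop)) ?_
    intro f
    rw [hV]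
    exact hbd f
  let φ : K →L[ℂ] ℂ := (lp.evalCLM ℂ (fun _ : Γ => ℂ) 2 1).comp V
  let g : K := (InnerProductSpace.toDual ℂ K).symm φ
  have hg : ∀ u : K, ⟪(g : H), (u : H)⟫ = V u 1 := by
    intro u
    exact InnerProductSpace.toDual_symm_apply (𝕜 := ℂ) (E := K)
  have hgγ : ∀ γ (u : K), ‖⟪(u : H), π γ g⟫‖ = ‖V u γ‖ := by
    intro γ u
    have hev : Continuous fun u : K => V u γ :=
      ((lp.evalCLM ℂ (fun _ : Γ => ℂ) 2 γ).comp V).continuous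
    refine hP'd.induction_on (p := fun u : K => ‖⟪(u : H), π γ g⟫‖ = ‖V u γ‖) u
      (isClosed_eq (by fun_prop) (by fun_prop)) ?_
    intro f
    have h1 : ⟪π γ (g : H), P f⟫ = ⟪(g : H), P ((π γ).symm f)⟫ := by
      rw [← (π γ).inner_map_map (g : H), ← hPπ, LinearIsometryEquiv.apply_symm_apply]
    have h2 : ⟪(g : H), P ((π γ).symm f)⟫ = A ((π γ).symm f) 1 := by
      rw [← hV]
      exact hg (P' ((π γ).symm f))
    have h3 : T ((π γ).symm f) = (π γ).symm (T f) := by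
      rw [LinearIsometryEquiv.eq_symm_apply, ← hT, LinearIsometryEquiv.apply_symm_apply]
    rw [norm_inner_symm, hV, hA]
    change ‖⟪π γ (g : H), P f⟫‖ = _
    rw [h1, h2, hA, h3, aux_coef_symm hrep, mul_one]
  refine ⟨g, ?_, ?_⟩
  · intro γ
    have hg' := g.2
    generalize (g : H) = g' at hg' ⊢
    rw [← Submodule.orthogonal_orthogonal K]
    intro w hw
    rw [hperp] at hw
    have h1 : (π γ).symm w ∈ Kᗮ := by
      rw [hperp]
      intro x
      rw [← norm_eq_zero, aux_coef_symm hrep, hw, norm_zero]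
    have h2 := Submodule.inner_left_of_mem_orthogonal hg' h1
    rw [← h2, ← (π γ).inner_map_map _ g', LinearIsometryEquiv.apply_symm_apply]
  · intro f hf
    have h1 := aux_hasSum (V ⟨f, hf⟩)
    rw [hVn] at h1
    simp only [← hgγ] at h1
    exact h1

end Aux

theorem stmt_6
    {Γ : Type*} [Group Γ] [Countable Γ]
    {H : Type*} [NormedAddCommGroup H] [InnerProductSpace ℂ H] [CompleteSpace H]
    [TopologicalSpace.SeparableSpace H]
    (σ : Γ → Γ → ℂ) (π : Γ → H ≃ₗᵢ[ℂ] H)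
    (hrep : IsProjectiveRep σ π)
    (hsq : IsSquareIntegrableRep π)
    :
    (∀ h : H, ∃ g : H,
      (∀ γ : Γ, π γ g ∈
        (Submodule.span ℂ (Set.range fun γ' : Γ => π γ' h)).topologicalClosure) ∧
      ∀ f ∈ (Submodule.span ℂ (Set.range fun γ' : Γ => π γ' h)).topologicalClosure,
        HasSum (fun γ : Γ => ‖⟪f, π γ g⟫‖ ^ 2) (‖f‖ ^ 2)) ∧
    ((∃ h : H, IsCyclicVector π h) → ∃ g : H, IsParsevalFrame π g) := by
  refine ⟨fun h => aux_main hrep hsq h, ?_⟩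
  rintro ⟨h, hc⟩
  obtain ⟨g, -, hg⟩ := aux_main hrep hsq h
  refine ⟨g, fun f => hg f ?_⟩
  rw [← SetLike.mem_coe, Submodule.topologicalClosure_coe]
  exact hc f
end
end

section
/- Let (π, H) be a square-integrable σ-representation of a countable discrete group Γ on a separable complex Hilbert space H, and suppose (Γ, σ) satisfies Kleppner's condition. If K ⊆ H is a closed subspace that is invariant both under π(γ) for every γ ∈ Γ and under every operator T ∈ π(Γ)' (i.e., π(γ)K ⊆ K and TK ⊆ K), then K = {0} or K = H. -/
open MeasureTheory
open scoped ENNReal ComplexInnerProductSpace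

noncomputable section

section Helpers

variable {Γ : Type*} [Group Γ] {H : Type*} [NormedAddCommGroup H] [InnerProductSpace ℂ H]

/-- The Hilbert space of square-summable functions. -/
abbrev L2 (Γ : Type*) := lp (fun _ : Γ => ℂ) 2

lemma memL2 {v : Γ → ℂ} (h : Summable fun x => ‖v x‖ ^ 2) : Memℓp v 2 := by
  apply memℓp_gen
  simpa using h

lemma L2_summable (v : L2 Γ) : Summable fun x => ‖v x‖ ^ 2 := by
  have := (memℓp_gen_iff (p := 2) (by norm_num)).1 (lp.memℓp v)
  simpa using this

/-- All coefficients against `g` are square-summable. -/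
def SI (π : Γ → H ≃ₗᵢ[ℂ] H) (g : H) : Prop :=
  ∀ f : H, Summable fun γ : Γ => ‖⟪f, π γ g⟫‖ ^ 2

lemma inner_twist (e : Γ ≃ Γ) (φ : Γ → ℂ) (hφ : ∀ x, ‖φ x‖ = 1) (v w v' w' : L2 Γ)
    (hv : ∀ x, v' x = φ x * v (e x)) (hw : ∀ x, w' x = φ x * w (e x)) :
    ⟪v', w'⟫ = ⟪v, w⟫ := by
  rw [lp.inner_eq_tsum, lp.inner_eq_tsum, ← e.tsum_eq (fun i => ⟪v i, w i⟫)]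
  congr 1
  ext x
  rw [hv, hw]
  have h1 : φ x * (starRingEnd ℂ) (φ x) = 1 := by
    rw [Complex.mul_conj, Complex.normSq_eq_norm_sq, hφ]; simp
  simp only [RCLike.inner_apply, map_mul]
  linear_combination (w (e x) * (starRingEnd ℂ) (v (e x))) * h1

lemma SI.symm_summable {π : Γ → H ≃ₗᵢ[ℂ] H} {g : H} (hg : SI π g) (f : H) :
    Summable fun γ : Γ => ‖⟪π γ g, f⟫‖ ^ 2 := by
  simpa only [norm_inner_symm] using hg f

/-- The coefficient operator, as a linear map. -/
def coefL (π : Γ → H ≃ₗᵢ[ℂ] H) (g : H) (hg : SI π g) : H →ₗ[ℂ] L2 Γ where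
  toFun f := ⟨fun x => ⟪π x g, f⟫, memL2 (hg.symm_summable f)⟩
  map_add' f f' := by
    ext x
    exact inner_add_right _ _ _
  map_smul' c f := by
    ext x
    simp [inner_smul_right]

/-- The coefficient operator, as a continuous linear map. -/
def coef [CompleteSpace H] (π : Γ → H ≃ₗᵢ[ℂ] H) (g : H) (hg : SI π g) : H →L[ℂ] L2 Γ :=
  ContinuousLinearMap.ofSeqClosedGraph (g := coefL π g hg) (by
    intro u x y hu hy
    ext i
    have h1 : Filter.Tendsto (fun n => (coefL π g hg (u n)) i) Filter.atTop (nhds (y i)) := by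
      have h0 : Filter.Tendsto (fun n => ‖(coefL π g hg (u n)) - y‖) Filter.atTop (nhds 0) :=
        tendsto_iff_norm_sub_tendsto_zero.1 hy
      rw [tendsto_iff_norm_sub_tendsto_zero]
      refine squeeze_zero (fun _ => norm_nonneg _) (fun n => ?_) h0
      exact lp.norm_apply_le_norm (by norm_num) (coefL π g hg (u n) - y) i
    have h2 : Filter.Tendsto (fun n => (coefL π g hg (u n)) i) Filter.atTop
        (nhds ((coefL π g hg x) i)) :=
      Filter.Tendsto.inner tendsto_const_nhds hu
    exact tendsto_nhds_unique h1 h2)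

lemma coef_apply [CompleteSpace H] (π : Γ → H ≃ₗᵢ[ℂ] H) (g : H) (hg : SI π g) (f : H) (x : Γ) :
    coef π g hg f x = ⟪π x g, f⟫ := rfl

lemma conj_mul_self_of_norm {z : ℂ} (hz : ‖z‖ = 1) : (starRingEnd ℂ) z * z = 1 := by
  rw [mul_comm, Complex.mul_conj, Complex.normSq_eq_norm_sq, hz]; simp

lemma pi_mul {σ : Γ → Γ → ℂ} {π : Γ → H ≃ₗᵢ[ℂ] H} (hrep : IsProjectiveRep σ π) (x y : Γ) (f : H) :
    π (x * y) f = (starRingEnd ℂ) (σ x y) • π x (π y f) := by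
  rw [hrep.2.2.2.2, smul_smul, conj_mul_self_of_norm (hrep.1 x y), one_smul]

lemma pi_symm {σ : Γ → Γ → ℂ} {π : Γ → H ≃ₗᵢ[ℂ] H} (hrep : IsProjectiveRep σ π) (y : Γ) (f : H) :
    (π y).symm f = (starRingEnd ℂ) (σ y y⁻¹) • π y⁻¹ f := by
  rw [LinearIsometryEquiv.symm_apply_eq, map_smul, ← pi_mul hrep, mul_inv_cancel, hrep.2.2.2.1]
  rfl

lemma SI.pi {σ : Γ → Γ → ℂ} {π : Γ → H ≃ₗᵢ[ℂ] H} (hrep : IsProjectiveRep σ π) {g : H}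
    (hg : SI π g) (y : Γ) : SI π (π y g) := by
  intro f
  have h := (Equiv.mulRight y).summable_iff.2 (hg f)
  refine h.congr (fun x => ?_)
  simp [hrep.2.2.2.2, inner_smul_right, hrep.1]

lemma SI.smul {π : Γ → H ≃ₗᵢ[ℂ] H} {g : H} (hg : SI π g) (c : ℂ) : SI π (c • g) := by
  intro f
  refine ((hg f).mul_left (‖c‖ ^ 2)).congr (fun x => ?_)
  simp [inner_smul_right, mul_pow]

lemma SI.symm {σ : Γ → Γ → ℂ} {π : Γ → H ≃ₗᵢ[ℂ] H} (hrep : IsProjectiveRep σ π) {g : H}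
    (hg : SI π g) (y : Γ) : SI π ((π y).symm g) := by
  rw [pi_symm hrep]
  exact (hg.pi hrep _).smul _

lemma symm_mem {σ : Γ → Γ → ℂ} {π : Γ → H ≃ₗᵢ[ℂ] H} (hrep : IsProjectiveRep σ π)
    {K : Submodule ℂ H} (hKπ : ∀ γ : Γ, ∀ f ∈ K, π γ f ∈ K) (y : Γ) {f : H} (hf : f ∈ K) :
    (π y).symm f ∈ K := by
  rw [pi_symm hrep]
  exact K.smul_mem _ (hKπ _ _ hf)

lemma inner_pi_left (π : Γ → H ≃ₗᵢ[ℂ] H) (y : Γ) (a b : H) :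
    ⟪a, π y b⟫ = ⟪(π y).symm a, b⟫ := by
  rw [← (π y).inner_map_map ((π y).symm a) b]; simp

lemma orth_inv {σ : Γ → Γ → ℂ} {π : Γ → H ≃ₗᵢ[ℂ] H} (hrep : IsProjectiveRep σ π)
    {K : Submodule ℂ H} (hKπ : ∀ γ : Γ, ∀ f ∈ K, π γ f ∈ K) :
    ∀ γ : Γ, ∀ f ∈ Kᗮ, π γ f ∈ Kᗮ := by
  intro γ f hf
  rw [Submodule.mem_orthogonal] at hf ⊢
  intro u hu
  rw [inner_pi_left]
  exact hf _ (symm_mem hrep hKπ γ hu)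

/-- The mixed frame operator commutes with the representation. -/
lemma frame_comm [CompleteSpace H] {σ : Γ → Γ → ℂ} {π : Γ → H ≃ₗᵢ[ℂ] H}
    (hrep : IsProjectiveRep σ π) (g h : H) (hg : SI π g) (hh : SI π h) :
    (ContinuousLinearMap.adjoint (coef π h hh)) ∘L (coef π g hg) ∈ RepCommutant π := by
  intro y f
  refine ext_inner_left ℂ (fun f' => ?_)
  rw [inner_pi_left]
  simp only [ContinuousLinearMap.comp_apply, ContinuousLinearMap.adjoint_inner_right]
  have key : ∀ (g : H) (hg : SI π g) (f : H) (x : Γ), coef π g hg (π y f) x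
      = σ y (y⁻¹ * x) * coef π g hg f (Equiv.mulLeft y⁻¹ x) := by
    intro g hg f x
    simp only [coef_apply, Equiv.coe_mulLeft]
    have : π x g = (starRingEnd ℂ) (σ y (y⁻¹ * x)) • π y (π (y⁻¹ * x) g) := by
      rw [← pi_mul hrep, mul_inv_cancel_left]
    rw [this, inner_smul_left, LinearIsometryEquiv.inner_map_map]
    simp
  refine inner_twist (Equiv.mulLeft y⁻¹) (fun x => σ y (y⁻¹ * x)) (fun x => hrep.1 _ _) _ _ _ _
    (fun x => ?_) (fun x => key g hg f x)
  rw [← key, LinearIsometryEquiv.apply_symm_apply]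

lemma coef_orth [CompleteSpace H] {σ : Γ → Γ → ℂ} {π : Γ → H ≃ₗᵢ[ℂ] H}
    (hrep : IsProjectiveRep σ π) (K : Submodule ℂ H) [K.HasOrthogonalProjection]
    (hKπ : ∀ γ : Γ, ∀ f ∈ K, π γ f ∈ K)
    (hKcom : ∀ T ∈ RepCommutant π, ∀ f ∈ K, T f ∈ K)
    (g h : H) (hg : SI π g) (hh : SI π h) (hgK : g ∈ K) (hhK : h ∈ Kᗮ) (f f' : H) :
    ⟪coef π h hh f', coef π g hg f⟫ = 0 := by
  have e1 : coef π g hg f = coef π g hg (K.starProjection f) := by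
    ext x
    rw [coef_apply, coef_apply, ← sub_eq_zero, ← inner_sub_right]
    exact (Submodule.mem_orthogonal _ _).1 (K.sub_starProjection_mem_orthogonal f) _ (hKπ x g hgK)
  have e2 : coef π h hh f' = coef π h hh (f' - K.starProjection f') := by
    ext x
    rw [coef_apply, coef_apply, inner_sub_right, eq_comm, sub_eq_self]
    exact (Submodule.mem_orthogonal' _ _).1 (orth_inv hrep hKπ x h hhK) _
      (K.starProjection_apply_mem f')
  rw [e1, e2, ← ContinuousLinearMap.adjoint_inner_right]
  exact (Submodule.mem_orthogonal' _ _).1 (K.sub_starProjection_mem_orthogonal f') _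
    (hKcom _ (frame_comm hrep g h hg hh) _ (K.starProjection_apply_mem f))

lemma eq_bot_of_SI {π : Γ → H ≃ₗᵢ[ℂ] H} (hsq : IsSquareIntegrableRep π)
    (K : Submodule ℂ H) [K.HasOrthogonalProjection]
    (hKπ : ∀ γ : Γ, ∀ f ∈ K, π γ f ∈ K) (hKo : ∀ γ : Γ, ∀ f ∈ Kᗮ, π γ f ∈ Kᗮ)
    (h0 : ∀ g ∈ K, SI π g → g = 0) : K = ⊥ := by
  obtain ⟨D, hD, hs⟩ := hsq
  rw [Submodule.eq_bot_iff]
  intro k hk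
  refine hD.eq_zero_of_inner_left (𝕜 := ℂ) (fun v hv => ?_)
  have hz : K.starProjection (v : H) = 0 := by
    refine h0 _ (K.starProjection_apply_mem _) (fun f => ?_)
    refine (hs (K.starProjection f) v hv).congr (fun x => ?_)
    congr 2
    have a1 : ⟪K.starProjection f, π x ((v : H) - K.starProjection (v : H))⟫ = 0 :=
      (Submodule.mem_orthogonal _ _).1 (hKo x _ (K.sub_starProjection_mem_orthogonal _)) _
        (K.starProjection_apply_mem f)
    have a2 : ⟪f - K.starProjection f, π x (K.starProjection (v : H))⟫ = 0 :=
      (Submodule.mem_orthogonal' _ _).1 (K.sub_starProjection_mem_orthogonal f) _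
        (hKπ x _ (K.starProjection_apply_mem _))
    rw [map_sub, inner_sub_right] at a1
    rw [inner_sub_left] at a2
    linear_combination a1 - a2
  have := (Submodule.starProjection_apply_eq_zero_iff K).1 hz
  exact (Submodule.mem_orthogonal _ _).1 this k hk

/-- A vector invariant under twisted conjugation is supported at the identity. -/
lemma supp_one {σ : Γ → Γ → ℂ} (hσ : ∀ x y : Γ, ‖σ x y‖ = 1) (hK : KleppnerCondition σ)
    (q : L2 Γ)
    (hq : ∀ y x : Γ, q x = (starRingEnd ℂ) (σ x y) * σ y (y⁻¹ * x * y) * q (y⁻¹ * x * y))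
    (x : Γ) (hx : x ≠ 1) : q x = 0 := by
  by_contra hne
  have hreg : IsSigmaRegular σ x := by
    intro y hy
    have e : y⁻¹ * x * y = x := by rw [mul_assoc, ← hy, inv_mul_cancel_left]
    have h1 := hq y x
    rw [e] at h1
    have h2 : (starRingEnd ℂ) (σ x y) * σ y x = 1 := by
      apply mul_right_cancel₀ hne
      rw [← h1, one_mul]
    have h3 := conj_mul_self_of_norm (hσ x y)
    have h4 : (starRingEnd ℂ) (σ x y) ≠ 0 := left_ne_zero_of_mul_eq_one h3
    exact mul_left_cancel₀ h4 (h3.trans h2.symm)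
  have hinf := hK x hx hreg
  apply hinf
  have hs := L2_summable q
  have hev := hs.tendsto_cofinite_zero.eventually_lt_const (show 0 < ‖q x‖ ^ 2 by positivity)
  refine Set.Finite.subset (Filter.eventually_cofinite.1 hev) ?_
  rintro _ ⟨y, rfl⟩
  have h1 := hq y (y * x * y⁻¹)
  have e : y⁻¹ * (y * x * y⁻¹) * y = x := by group
  rw [e] at h1
  have h2 : ‖q (y * x * y⁻¹)‖ = ‖q x‖ := by rw [h1]; simp [hσ]
  simp [h2]

end Helpers

theorem stmt_10
    {Γ : Type*} [Group Γ] [Countable Γ]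
    {H : Type*} [NormedAddCommGroup H] [InnerProductSpace ℂ H] [CompleteSpace H]
    [TopologicalSpace.SeparableSpace H]
    (σ : Γ → Γ → ℂ) (π : Γ → H ≃ₗᵢ[ℂ] H)
    (hrep : IsProjectiveRep σ π)
    (hsq : IsSquareIntegrableRep π)
    (hK : KleppnerCondition σ)
    (K : Submodule ℂ H) (hKcl : IsClosed (K : Set H))
    (hKπ : ∀ γ : Γ, ∀ f ∈ K, π γ f ∈ K)
    (hKcom : ∀ T ∈ RepCommutant π, ∀ f ∈ K, T f ∈ K) :
    K = ⊥ ∨ K = ⊤ := by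
  classical
  have : CompleteSpace K := hKcl.completeSpace_coe
  have hKo := orth_inv hrep hKπ
  have π1 : ∀ f, π 1 f = f := fun f => by rw [hrep.2.2.2.1]; rfl
  -- the coefficient vectors of the orthogonal complement, and their orthogonal
  set N : Set (L2 Γ) := {v | ∃ (h : H) (hh : SI π h) (f : H), h ∈ Kᗮ ∧ v = coef π h hh f} with hN
  set M : Submodule ℂ (L2 Γ) := (Submodule.span ℂ N)ᗮ with hM
  have memM : ∀ v : L2 Γ, v ∈ M ↔ ∀ n ∈ N, ⟪n, v⟫ = 0 := by
    intro v
    rw [hM, Submodule.mem_orthogonal]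
    constructor
    · intro h n hn
      exact h n (Submodule.subset_span hn)
    · intro h u hu
      induction hu using Submodule.span_induction with
      | mem x hx => exact h x hx
      | zero => simp
      | add x y _ _ hx hy => rw [inner_add_left, hx, hy, add_zero]
      | smul a x _ hx => rw [inner_smul_left, hx, mul_zero]
  set δ : L2 Γ := lp.single 2 (1 : Γ) (1 : ℂ) with hδ
  have δi : ∀ v : L2 Γ, ⟪δ, v⟫ = v 1 := by
    intro v
    rw [hδ, lp.inner_single_left]
    simp
  set q : L2 Γ := M.starProjection δ with hqdef
  have qM : q ∈ M := M.starProjection_apply_mem δ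
  have qi : ∀ v ∈ M, ⟪q, v⟫ = v 1 := by
    intro v hv
    rw [← δi, ← sub_eq_zero, ← neg_eq_zero, neg_sub, ← inner_sub_left]
    exact M.starProjection_inner_eq_zero δ v hv
  -- invariance under twisted conjugation
  have hinv : ∀ y x : Γ, q x = (starRingEnd ℂ) (σ x y) * σ y (y⁻¹ * x * y) * q (y⁻¹ * x * y) := by
    intro y
    set e : Γ ≃ Γ := (MulAut.conj y⁻¹).toEquiv with he
    have e_apply : ∀ x, e x = y⁻¹ * x * y := fun x => by simp [he]
    set φ : Γ → ℂ := fun x => (starRingEnd ℂ) (σ x y) * σ y (y⁻¹ * x * y) with hφ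
    have φ1 : ∀ x, ‖φ x‖ = 1 := fun x => by simp [hφ, hrep.1]
    have hmem : Memℓp (fun x => φ x * q (e x)) 2 := by
      apply memL2
      refine (e.summable_iff.2 (L2_summable q)).congr (fun x => ?_)
      simp [φ1]
    set q' : L2 Γ := ⟨fun x => φ x * q (e x), hmem⟩ with hq'
    have q'_apply : ∀ x, q' x = φ x * q (e x) := fun x => rfl
    have q'M : q' ∈ M := by
      rw [memM]
      rintro _ ⟨h, hh, f, hhK, rfl⟩
      have hh' : SI π ((π y).symm h) := hh.symm hrep y
      have hhK' : (π y).symm h ∈ Kᗮ := symm_mem hrep hKo y hhK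
      rw [← (memM q).1 qM _ ⟨_, hh', (π y).symm f, hhK', rfl⟩]
      refine inner_twist e φ φ1 _ _ _ _ (fun x => ?_) q'_apply
      rw [coef_apply, coef_apply, e_apply]
      have h1 : π x h = σ x y • (starRingEnd ℂ) (σ y (y⁻¹ * x * y)) •
          π y (π (y⁻¹ * x * y) ((π y).symm h)) := by
        rw [← pi_mul hrep, ← mul_assoc, mul_inv_cancel_left, ← hrep.2.2.2.2,
          LinearIsometryEquiv.apply_symm_apply]
      rw [h1, inner_smul_left, inner_smul_left, ← (π y).inner_map_map _ ((π y).symm f),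
        LinearIsometryEquiv.apply_symm_apply]
      simp [hφ, mul_assoc]
    have hqq' : ⟪q, q'⟫ = q 1 := by
      rw [qi _ q'M, q'_apply, e_apply]
      simp [hφ, (hrep.2.2.1 y).1, (hrep.2.2.1 y).2]
    have hqq : ⟪q, q⟫ = q 1 := qi q qM
    have hq'q' : ⟪q', q'⟫ = q 1 := by
      rw [← hqq]
      exact inner_twist e φ φ1 _ _ _ _ q'_apply q'_apply
    have hq'q : ⟪q', q⟫ = q 1 := by
      rw [← inner_conj_symm, hqq', ← hqq, inner_conj_symm]
    have hz : q - q' = 0 := by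
      rw [← inner_self_eq_zero (𝕜 := ℂ), inner_sub_left, inner_sub_right, inner_sub_right,
        hqq, hqq', hq'q, hq'q']
      ring
    intro x
    have := q'_apply x
    rw [← sub_eq_zero.1 hz, e_apply] at this
    exact this
  have hsupp := supp_one hrep.1 hK q hinv
  set c : ℂ := q 1 with hc
  have hqc : q = c • δ := by
    ext x
    by_cases hx : x = 1
    · subst hx
      simp [hδ, hc]
    · rw [hsupp x hx]
      simp [hδ, lp.single_apply_ne, hx]
  by_cases hc0 : c = 0
  · left
    refine eq_bot_of_SI hsq K hKπ hKo (fun g hg hgs => ?_)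
    have hm : coef π g hgs g ∈ M := by
      rw [memM]
      rintro _ ⟨h, hh, f, hhK, rfl⟩
      exact coef_orth hrep K hKπ hKcom g h hgs hh hg hhK _ _
    have h1 := qi _ hm
    rw [hqc, hc0, zero_smul, inner_zero_left, coef_apply, π1] at h1
    exact inner_self_eq_zero.1 h1.symm
  · right
    have hδM : δ ∈ M := by
      have : δ = c⁻¹ • q := by rw [hqc, smul_smul, inv_mul_cancel₀ hc0, one_smul]
      rw [this]
      exact M.smul_mem _ qM
    have hKobot : Kᗮ = ⊥ := by
      refine eq_bot_of_SI hsq Kᗮ hKo (orth_inv hrep hKo) (fun h hh hhs => ?_)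
      have h1 := (memM δ).1 hδM _ ⟨h, hhs, h, hh, rfl⟩
      rw [← inner_conj_symm, δi, coef_apply, π1, inner_conj_symm] at h1
      exact inner_self_eq_zero.1 h1
    exact (Submodule.orthogonal_eq_bot_iff).1 hKobot
end
end
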